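/- arXiv:2603.15264 — 10 statements merged into one kernel-verified Lean document; each statement's English description precedes it below -/
import Mathlib

section
/- Let M be a uniformly controlled coarse median diagram with data (J, A, s, t, (X_j), (μ_j), (D_a), C, ρ, c). Let W be a quasigeodesic metric space together with maps λ_j : W → X_j (j ∈ J) admitting a common upper control, and a constant κ ≥ 0 such that d(λ_{t(a)}(w), D_a(λ_{s(a)}(w))) ≤ κ for all a ∈ A and w ∈ W. Suppose this cone is a universal quasigeodesic uniformly controlled cone over the underlying diagram of metric spaces: for every quasigeodesic metric space Z and every family of maps ζ_j : Z → X_j admitting a common upper control for which there is κ' ≥ 0 with d(ζ_{t(a)}(z), D_a(ζ_{s(a)}(z))) ≤ κ' for all a ∈ A and z ∈ Z, there exists a controlled map f : Z → W with sup over j ∈ J and z ∈ Z of d(ζ_j(z), λ_j(f(z))) finite, and any two such maps f are close. Then there exist a coarse median ν on W and a constant r ≥ 0 such that every λ_j is r-CMP from (W, ν) to (X_j, μ_j); moreover, if ν' is any coarse median on W for which there is r' ≥ 0 such that every λ_j is r'-CMP from (W, ν') to (X_j, μ_j), then ν and ν' are close. -/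
open Filter

universe u v

/-- An upper control function: an increasing proper function `[0,∞) → [0,∞)`. -/
def ProperCtrl (ρ : ℝ → ℝ) : Prop :=
  Monotone ρ ∧ Tendsto ρ atTop atTop ∧ ∀ t : ℝ, 0 ≤ t → 0 ≤ ρ t

/-- `μ` is a coarse median on `X` with constant `C` and upper control `ρ`. -/
def IsCoarseMedian {X : Type*} [MetricSpace X] (μ : X → X → X → X) (C : ℝ) (ρ : ℝ → ℝ) : Prop :=
  (∀ (x x' y y' z z' : X) (t : ℝ), dist x x' ≤ t → dist y y' ≤ t → dist z z' ≤ t →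
      dist (μ x y z) (μ x' y' z') ≤ ρ t) ∧
  (∀ (τ : Equiv.Perm (Fin 3)) (v : Fin 3 → X),
      dist (μ (v (τ 0)) (v (τ 1)) (v (τ 2))) (μ (v 0) (v 1) (v 2)) ≤ C) ∧
  (∀ x y : X, dist (μ x x y) x ≤ C) ∧
  (∀ x y z w : X, dist (μ (μ x w y) w z) (μ x w (μ y w z)) ≤ C)

/-- `f` is `κ`-coarse-median-preserving with respect to ternary operators `μ`, `ν`. -/
def IsCMP {X Y : Type*} [MetricSpace X] [MetricSpace Y]
    (f : X → Y) (μ : X → X → X → X) (ν : Y → Y → Y → Y) (κ : ℝ) : Prop :=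
  ∀ x y z : X, dist (f (μ x y z)) (ν (f x) (f y) (f z)) ≤ κ

/-- A tuple is `κ`-consistent for the diagram with bonding maps `D`. -/
def Consistent {J A : Type u} (src tgt : A → J) (X : J → Type v) [∀ j, MetricSpace (X j)]
    (D : ∀ a, X (src a) → X (tgt a)) (κ : ℝ) (x : ∀ j, X j) : Prop :=
  ∀ a : A, dist (x (tgt a)) (D a (x (src a))) ≤ κ

/-- `ρ` is an upper control for `f`. -/
def UpperCtrl {X Y : Type*} [MetricSpace X] [MetricSpace Y] (f : X → Y) (ρ : ℝ → ℝ) : Prop :=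
  ∀ (x x' : X) (t : ℝ), dist x x' ≤ t → dist (f x) (f x') ≤ ρ t

/-- `f` is a controlled map. -/
def Controlled {X Y : Type*} [MetricSpace X] [MetricSpace Y] (f : X → Y) : Prop :=
  ∃ ρ : ℝ → ℝ, ProperCtrl ρ ∧ UpperCtrl f ρ

/-- `f` and `g` are close. -/
def Close {X Y : Type*} [MetricSpace Y] (f g : X → Y) : Prop :=
  ∃ K : ℝ, ∀ x : X, dist (f x) (g x) ≤ K

/-- `Z` is quasigeodesic. -/
def Quasigeodesic (Z : Type*) [MetricSpace Z] : Prop :=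
  ∃ σ a b : ℝ, 0 ≤ σ ∧ 0 ≤ a ∧ 0 ≤ b ∧ ∀ x y : Z, ∃ (n : ℕ) (ch : ℕ → Z),
    ch 0 = x ∧ ch n = y ∧ (∀ i < n, dist (ch i) (ch (i + 1)) ≤ σ) ∧
    (n : ℝ) ≤ a * dist x y + b

theorem ProperCtrl.comp {ρ ρ' : ℝ → ℝ} (h : ProperCtrl ρ) (h' : ProperCtrl ρ') :
    ProperCtrl (fun t => ρ (ρ' t)) :=
  ⟨h.1.comp h'.1, h.2.1.comp h'.2.1, fun t ht => h.2.2 _ (h'.2.2 t ht)⟩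

theorem properCtrl_id : ProperCtrl (fun t => t) :=
  ⟨monotone_id, tendsto_id, fun _ ht => ht⟩

/-- Extending a finite chain by its last point keeps its steps bounded. -/
theorem dist_min_succ_le {V : Type*} [MetricSpace V] {σ : ℝ} (hσ : 0 ≤ σ) {n : ℕ} {ch : ℕ → V}
    (h : ∀ i < n, dist (ch i) (ch (i + 1)) ≤ σ) (i : ℕ) :
    dist (ch (min i n)) (ch (min (i + 1) n)) ≤ σ := by
  rcases lt_or_ge i n with hi | hi
  · rw [min_eq_left hi.le, min_eq_left (Nat.succ_le_of_lt hi)]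
    exact h i hi
  · rw [min_eq_right hi, min_eq_right (hi.trans i.le_succ), dist_self]
    exact hσ

theorem Quasigeodesic.prod {Y Z : Type*} [MetricSpace Y] [MetricSpace Z]
    (hY : Quasigeodesic Y) (hZ : Quasigeodesic Z) : Quasigeodesic (Y × Z) := by
  obtain ⟨σ, a, b, hσ, ha, hb, h⟩ := hY
  obtain ⟨σ', a', b', hσ', ha', hb', h'⟩ := hZ
  refine ⟨max σ σ', max a a', max b b', le_max_of_le_left hσ, le_max_of_le_left ha,
    le_max_of_le_left hb, fun x y => ?_⟩
  obtain ⟨n, ch, h0, hn, hs, hl⟩ := h x.1 y.1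
  obtain ⟨n', ch', h0', hn', hs', hl'⟩ := h' x.2 y.2
  refine ⟨max n n', fun i => (ch (min i n), ch' (min i n')), ?_, ?_, fun i _ => ?_, ?_⟩
  · simp [h0, h0']
  · simp [hn, hn']
  · exact max_le_max (dist_min_succ_le hσ hs i) (dist_min_succ_le hσ' hs' i)
  · rw [Nat.cast_max, Prod.dist_eq]
    refine max_le (hl.trans ?_) (hl'.trans ?_)
    · gcongr <;> exact le_max_left _ _
    · gcongr <;> exact le_max_right _ _

/-- a universal quasigeodesic uniformly controlled cone over a uniformly
controlled coarse median diagram carries a canonical coarse median making the legs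
uniformly coarse-median-preserving, uniquely up to closeness. -/
theorem universal_quasigeodesic_cone_coarse_median
    {J A : Type u} (src tgt : A → J) (X : J → Type v) [∀ j, MetricSpace (X j)]
    (μ : ∀ j, X j → X j → X j → X j) (D : ∀ a, X (src a) → X (tgt a))
    (C c : ℝ) (ρ : ℝ → ℝ) (hC : 0 ≤ C) (hc : 0 ≤ c) (hρ : ProperCtrl ρ)
    (hmed : ∀ j, IsCoarseMedian (μ j) C ρ)
    (hDctrl : ∀ a, UpperCtrl (D a) ρ)
    (hDcmp : ∀ a : A, IsCMP (D a) (μ (src a)) (μ (tgt a)) c)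
    (W : Type v) [MetricSpace W] (hW : Quasigeodesic W)
    (lam : ∀ j, W → X j)
    (hlamctrl : ∃ ρ' : ℝ → ℝ, ProperCtrl ρ' ∧ ∀ j, UpperCtrl (lam j) ρ')
    (κ : ℝ) (hκ : 0 ≤ κ)
    (hcone : ∀ (a : A) (w : W), dist (lam (tgt a) w) (D a (lam (src a) w)) ≤ κ)
    (huniv : ∀ (Z : Type v) [MetricSpace Z], Quasigeodesic Z →
      ∀ ζ : ∀ j, Z → X j,
        (∃ ρ' : ℝ → ℝ, ProperCtrl ρ' ∧ ∀ j, UpperCtrl (ζ j) ρ') →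
        (∃ κ' : ℝ, 0 ≤ κ' ∧ ∀ (a : A) (z : Z),
            dist (ζ (tgt a) z) (D a (ζ (src a) z)) ≤ κ') →
        (∃ f : Z → W, Controlled f ∧
            ∃ K : ℝ, ∀ (j : J) (z : Z), dist (ζ j z) (lam j (f z)) ≤ K) ∧
        ∀ f g : Z → W,
          (Controlled f ∧ ∃ K : ℝ, ∀ (j : J) (z : Z), dist (ζ j z) (lam j (f z)) ≤ K) →
          (Controlled g ∧ ∃ K : ℝ, ∀ (j : J) (z : Z), dist (ζ j z) (lam j (g z)) ≤ K) →
          Close f g) :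
    ∃ ν : W → W → W → W,
      (∃ C' ρ', 0 ≤ C' ∧ ProperCtrl ρ' ∧ IsCoarseMedian ν C' ρ') ∧
      (∃ r : ℝ, 0 ≤ r ∧ ∀ j, IsCMP (lam j) ν (μ j) r) ∧
      ∀ ν' : W → W → W → W,
        (∃ C' ρ', 0 ≤ C' ∧ ProperCtrl ρ' ∧ IsCoarseMedian ν' C' ρ') →
        (∃ r' : ℝ, 0 ≤ r' ∧ ∀ j, IsCMP (lam j) ν' (μ j) r') →
        ∃ K : ℝ, ∀ w₁ w₂ w₃ : W, dist (ν w₁ w₂ w₃) (ν' w₁ w₂ w₃) ≤ K := by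
  obtain ⟨ρl, hρl, hl⟩ := hlamctrl
  have close_of_legs : ∀ (Z : Type v) [MetricSpace Z], Quasigeodesic Z → ∀ f g : Z → W,
      Controlled f → Controlled g →
      (∃ K : ℝ, ∀ j z, dist (lam j (f z)) (lam j (g z)) ≤ K) → Close f g := by
    intro Z _ hZ f g hf hg hK
    obtain ⟨ρf, hρf, hfc⟩ := hf
    exact (huniv Z hZ (fun j z => lam j (f z))
      ⟨_, hρl.comp hρf, fun j x x' t ht => hl j _ _ _ (hfc x x' t ht)⟩
      ⟨κ, hκ, fun a z => hcone a (f z)⟩).2 f g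
      ⟨⟨ρf, hρf, hfc⟩, 0, fun j z => (dist_self _).le⟩ ⟨hg, hK⟩
  have hW2 : Quasigeodesic (W × W) := hW.prod hW
  have hW3 : Quasigeodesic (W × W × W) := hW.prod hW2
  have hW4 : Quasigeodesic (W × W × W × W) := hW.prod hW3
  obtain ⟨f, ⟨ρf, hρf, hfc⟩, K, hK⟩ := (huniv (W × W × W) hW3
    (fun j p => μ j (lam j p.1) (lam j p.2.1) (lam j p.2.2))
    ⟨_, hρ.comp hρl, fun j p q t ht => by
      simp only [Prod.dist_eq, max_le_iff] at ht
      exact (hmed j).1 _ _ _ _ _ _ _ (hl j _ _ _ ht.1) (hl j _ _ _ ht.2.1) (hl j _ _ _ ht.2.2)⟩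
    ⟨ρ κ + c, add_nonneg (hρ.2.2 κ hκ) hc, fun a p =>
      (dist_triangle_right _ _ _).trans (add_le_add
        ((hmed _).1 _ _ _ _ _ _ _ (hcone a p.1) (hcone a p.2.1) (hcone a p.2.2))
        (hDcmp a _ _ _))⟩).1
  obtain ⟨ν, hν⟩ : ∃ ν : W → W → W → W, ∀ x y z, ν x y z = f (x, y, z) := ⟨_, fun _ _ _ => rfl⟩
  have hνc : ∀ (x x' y y' z z' : W) (t : ℝ), dist x x' ≤ t → dist y y' ≤ t → dist z z' ≤ t →
      dist (ν x y z) (ν x' y' z') ≤ ρf t := by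
    intro x x' y y' z z' t hx hy hz
    rw [hν, hν]
    exact hfc _ _ t (max_le hx (max_le hy hz))
  obtain ⟨r, hr0, hr⟩ : ∃ r : ℝ, 0 ≤ r ∧ ∀ j, IsCMP (lam j) ν (μ j) r := by
    refine ⟨max K 0, le_max_right _ _, fun j x y z => ?_⟩
    rw [dist_comm, hν]
    exact (hK j (x, y, z)).trans (le_max_left _ _)
  have hνctrl : Controlled fun p : W × W × W => ν p.1 p.2.1 p.2.2 := by
    refine ⟨ρf, hρf, fun p q t ht => ?_⟩
    simp only [Prod.dist_eq, max_le_iff] at ht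
    exact hνc _ _ _ _ _ _ _ ht.1 ht.2.1 ht.2.2
  have hsymm : ∀ τ : Equiv.Perm (Fin 3), ∃ B : ℝ, ∀ w : Fin 3 → W,
      dist (ν (w (τ 0)) (w (τ 1)) (w (τ 2))) (ν (w 0) (w 1) (w 2)) ≤ B := by
    intro τ
    obtain ⟨B, hB⟩ := close_of_legs (W × W × W) hW3
      (fun p => ν (![p.1, p.2.1, p.2.2] (τ 0)) (![p.1, p.2.1, p.2.2] (τ 1))
        (![p.1, p.2.1, p.2.2] (τ 2))) (fun p => ν p.1 p.2.1 p.2.2)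
      ⟨ρf, hρf, fun p q t ht => by
        simp only [Prod.dist_eq, max_le_iff] at ht
        have hi : ∀ i, dist (![p.1, p.2.1, p.2.2] i) (![q.1, q.2.1, q.2.2] i) ≤ t := by
          intro i
          fin_cases i
          exacts [ht.1, ht.2.1, ht.2.2]
        exact hνc _ _ _ _ _ _ _ (hi _) (hi _) (hi _)⟩ hνctrl
      ⟨r + C + r, fun j p => (dist_triangle4 _ _ _ _).trans (add_le_add (add_le_add (hr j _ _ _)
        ((hmed j).2.1 τ fun i => lam j (![p.1, p.2.1, p.2.2] i)))
        (by rw [dist_comm]; exact hr j _ _ _))⟩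
    refine ⟨B, fun w => ?_⟩
    have hw : ![w 0, w 1, w 2] = w := by
      ext i
      fin_cases i <;> rfl
    simpa only [hw] using hB (w 0, w 1, w 2)
  choose B hB using hsymm
  obtain ⟨B, hBle⟩ := Finite.exists_le B
  obtain ⟨L, hL⟩ := close_of_legs (W × W) hW2 (fun p => ν p.1 p.1 p.2) Prod.fst
    ⟨ρf, hρf, fun p q t ht => by
      simp only [Prod.dist_eq, max_le_iff] at ht
      exact hνc _ _ _ _ _ _ _ ht.1 ht.1 ht.2⟩
    ⟨_, properCtrl_id, fun p q t ht => (le_max_left _ _).trans ht⟩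
    ⟨r + C, fun j p => (dist_triangle _ _ _).trans (add_le_add (hr j _ _ _) ((hmed j).2.2.1 _ _))⟩
  have hρν : ProperCtrl fun t => ρf (max t (ρf t)) :=
    ⟨hρf.1.comp (monotone_id.max hρf.1),
      hρf.2.1.comp (tendsto_atTop_mono (fun t => le_max_left t (ρf t)) tendsto_id),
      fun t ht => hρf.2.2 _ (le_max_of_le_left ht)⟩
  obtain ⟨F, hF⟩ := close_of_legs (W × W × W × W) hW4
    (fun p => ν (ν p.1 p.2.2.2 p.2.1) p.2.2.2 p.2.2.1)
    (fun p => ν p.1 p.2.2.2 (ν p.2.1 p.2.2.2 p.2.2.1))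
    ⟨_, hρν, fun p q t ht => by
      simp only [Prod.dist_eq, max_le_iff] at ht
      obtain ⟨h1, h2, h3, h4⟩ := ht
      exact hνc _ _ _ _ _ _ _ (le_max_of_le_right (hνc _ _ _ _ _ _ _ h1 h4 h2))
        (le_max_of_le_left h4) (le_max_of_le_left h3)⟩
    ⟨_, hρν, fun p q t ht => by
      simp only [Prod.dist_eq, max_le_iff] at ht
      obtain ⟨h1, h2, h3, h4⟩ := ht
      exact hνc _ _ _ _ _ _ _ (le_max_of_le_left h1) (le_max_of_le_left h4)
        (le_max_of_le_right (hνc _ _ _ _ _ _ _ h2 h4 h3))⟩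
    ⟨r + ρ r + C + (r + ρ r), fun j p => (dist_triangle4 _ _ _ _).trans (add_le_add (add_le_add
      ((dist_triangle _ _ _).trans (add_le_add (hr j _ _ _)
        ((hmed j).1 _ _ _ _ _ _ r (hr j _ _ _) (by rwa [dist_self]) (by rwa [dist_self]))))
      ((hmed j).2.2.2 _ _ _ _))
      (by
        rw [dist_comm]
        exact (dist_triangle _ _ _).trans (add_le_add (hr j _ _ _)
          ((hmed j).1 _ _ _ _ _ _ r (by rwa [dist_self]) (by rwa [dist_self]) (hr j _ _ _)))))⟩
  refine ⟨ν, ⟨max 0 (max B (max L F)), ρf, le_max_left _ _, hρf, hνc, fun τ w => ?_,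
    fun x y => ?_, fun x y z w => ?_⟩, ⟨r, hr0, hr⟩, ?_⟩
  · exact ((hB τ w).trans (hBle τ)).trans (by simp)
  · exact (hL (x, y)).trans (by simp)
  · exact (hF (x, y, z, w)).trans (by simp)
  · rintro ν' ⟨C', ρ', -, hρ', hν'⟩ ⟨r', -, hr'⟩
    obtain ⟨E, hE⟩ := close_of_legs (W × W × W) hW3 (fun p => ν p.1 p.2.1 p.2.2)
      (fun p => ν' p.1 p.2.1 p.2.2) hνctrl
      ⟨ρ', hρ', fun p q t ht => by
        simp only [Prod.dist_eq, max_le_iff] at ht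
        exact hν'.1 _ _ _ _ _ _ _ ht.1 ht.2.1 ht.2.2⟩
      ⟨r + r', fun j p => (dist_triangle_right _ _ _).trans
        (add_le_add (hr j _ _ _) (hr' j _ _ _))⟩
    exact ⟨E, fun x y z => hE (x, y, z)⟩
end

section
/- Let M be a uniformly controlled coarse median diagram with data (J, A, s, t, (X_j), (μ_j), (D_a), C, ρ, c). Suppose the tuple filtration of the underlying diagram stabilises: there is κ₀ ≥ 0 such that for every κ ≥ κ₀ there is r ≥ 0 so that every κ-consistent tuple x ∈ Π_j X_j admits a κ₀-consistent tuple x' with sup_j d(x_j, x'_j) ≤ r. Then there is κ₁ ≥ κ₀ such that for every κ ≥ κ₁: the set Tuple^κ of κ-consistent tuples is an M-compatible approximate median subalgebra of Π_j X_j, and every M-compatible approximate median subalgebra U of Π_j X_j satisfies U ≺ Tuple^κ. -/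
open Filter

universe u v

theorem Consistent.mono {J A : Type u} {src tgt : A → J} {X : J → Type v} [∀ j, MetricSpace (X j)]
    {D : ∀ a, X (src a) → X (tgt a)} {κ κ' : ℝ} {x : ∀ j, X j}
    (hx : Consistent src tgt X D κ x) (h : κ ≤ κ') : Consistent src tgt X D κ' x :=
  fun a => (hx a).trans h

/-- The coordinatewise median of `κ`-consistent tuples is `(ρ κ + c)`-consistent. -/
theorem Consistent.median {J A : Type u} {src tgt : A → J} {X : J → Type v}
    [∀ j, MetricSpace (X j)] {D : ∀ a, X (src a) → X (tgt a)} {κ c : ℝ} {ρ : ℝ → ℝ}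
    {μ : ∀ j, X j → X j → X j → X j} {x y z : ∀ j, X j}
    (hx : Consistent src tgt X D κ x)
    (hμ : ∀ j, ∀ (x x' y y' z z' : X j) (t : ℝ), dist x x' ≤ t → dist y y' ≤ t →
      dist z z' ≤ t → dist (μ j x y z) (μ j x' y' z') ≤ ρ t)
    (hD : ∀ a : A, IsCMP (D a) (μ (src a)) (μ (tgt a)) c)
    (hy : Consistent src tgt X D κ y) (hz : Consistent src tgt X D κ z) :
    Consistent src tgt X D (ρ κ + c) (fun j => μ j (x j) (y j) (z j)) := fun a =>
  (dist_triangle_right _ _ _).trans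
    (add_le_add (hμ _ _ _ _ _ _ _ κ (hx a) (hy a) (hz a)) (hD a _ _ _))

/-- if the tuple filtration stabilises, then for all large `κ` the set of
`κ`-consistent tuples is an `M`-compatible approximate median subalgebra which is
`≺`-greatest among all `M`-compatible approximate median subalgebras. -/
theorem stable_tuples_greatest_subalgebra
    {J A : Type u} (src tgt : A → J) (X : J → Type v) [∀ j, MetricSpace (X j)]
    (μ : ∀ j, X j → X j → X j → X j) (D : ∀ a, X (src a) → X (tgt a))
    (C c : ℝ) (ρ : ℝ → ℝ) (hC : 0 ≤ C) (hc : 0 ≤ c) (hρ : ProperCtrl ρ)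
    (hmed : ∀ j, IsCoarseMedian (μ j) C ρ)
    (hDctrl : ∀ a, UpperCtrl (D a) ρ)
    (hDcmp : ∀ a : A, IsCMP (D a) (μ (src a)) (μ (tgt a)) c)
    (κ₀ : ℝ) (hκ₀ : 0 ≤ κ₀)
    (hstab : ∀ κ : ℝ, κ₀ ≤ κ → ∃ r : ℝ, 0 ≤ r ∧
      ∀ x : ∀ j, X j, Consistent src tgt X D κ x →
        ∃ x' : ∀ j, X j, Consistent src tgt X D κ₀ x' ∧ ∀ j, dist (x j) (x' j) ≤ r) :
    ∃ κ₁ : ℝ, κ₀ ≤ κ₁ ∧ ∀ κ : ℝ, κ₁ ≤ κ →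
      -- `Tuple^κ` is `M`-compatible:
      ((∃ κ' : ℝ, 0 ≤ κ' ∧ ∀ x : ∀ j, X j,
          Consistent src tgt X D κ x → Consistent src tgt X D κ' x) ∧
        -- `Tuple^κ` is an approximate median subalgebra:
        (∃ R : ℝ, 0 ≤ R ∧ ∀ x y z : ∀ j, X j,
          Consistent src tgt X D κ x → Consistent src tgt X D κ y →
          Consistent src tgt X D κ z →
          ∃ u : ∀ j, X j, Consistent src tgt X D κ u ∧
            ∀ j, dist (μ j (x j) (y j) (z j)) (u j) ≤ R) ∧
        -- every `M`-compatible approximate median subalgebra `U` satisfies `U ≺ Tuple^κ`: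
        ∀ U : Set (∀ j, X j),
          (∃ κ' : ℝ, 0 ≤ κ' ∧ ∀ x ∈ U, Consistent src tgt X D κ' x) →
          (∃ R : ℝ, 0 ≤ R ∧ ∀ x ∈ U, ∀ y ∈ U, ∀ z ∈ U,
            ∃ u ∈ U, ∀ j, dist (μ j (x j) (y j) (z j)) (u j) ≤ R) →
          ∃ r : ℝ, 0 ≤ r ∧ ∀ x ∈ U,
            ∃ x' : ∀ j, X j, Consistent src tgt X D κ x' ∧ ∀ j, dist (x j) (x' j) ≤ r) := by
  have stab : ∀ κ κ' : ℝ, κ₀ ≤ κ → ∃ r : ℝ, 0 ≤ r ∧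
      ∀ x : ∀ j, X j, Consistent src tgt X D κ' x →
        ∃ x' : ∀ j, X j, Consistent src tgt X D κ x' ∧ ∀ j, dist (x j) (x' j) ≤ r := by
    intro κ κ' hκ
    obtain ⟨r, hr, h⟩ := hstab (max κ₀ κ') (le_max_left _ _)
    refine ⟨r, hr, fun x hx => ?_⟩
    obtain ⟨x', hx', hd⟩ := h x (hx.mono (le_max_right _ _))
    exact ⟨x', hx'.mono hκ, hd⟩
  refine ⟨κ₀, le_rfl, fun κ hκ => ⟨⟨κ, hκ₀.trans hκ, fun _ hx => hx⟩, ?_, ?_⟩⟩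
  · obtain ⟨r, hr, h⟩ := stab κ (ρ κ + c) hκ
    exact ⟨r, hr, fun x y z hx hy hz =>
      h _ (hx.median (fun j => (hmed j).1) hDcmp hy hz)⟩
  · rintro U ⟨κ', -, hU⟩ -
    obtain ⟨r, hr, h⟩ := stab κ κ' hκ
    exact ⟨r, hr, fun x hx => h x (hU x hx)⟩
end

section
/- Let (X, μ) be a metric space with a coarse median μ (with some constant C ≥ 0 and upper control ρ), let W be a metric space, and let f : W → X be a coarse equivalence. Then there exists a coarse median ν on W such that f is CMP from (W, ν) to (X, μ). -/
open Filter

universe u v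

/-- `f` is a coarse equivalence. -/
def CoarseEquiv {X Y : Type*} [MetricSpace X] [MetricSpace Y] (f : X → Y) : Prop :=
  Controlled f ∧ ∃ g : Y → X, Controlled g ∧ Close (g ∘ f) id ∧ Close (f ∘ g) id

/-- pulling back a coarse median along a coarse equivalence (existence). -/
theorem coarse_equiv_pullback_median {X W : Type*} [MetricSpace X] [MetricSpace W]
    (μ : X → X → X → X) (C : ℝ) (ρ : ℝ → ℝ)
    (hC : 0 ≤ C) (hρ : ProperCtrl ρ) (hμ : IsCoarseMedian μ C ρ)
    (f : W → X) (hf : CoarseEquiv f) :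
    ∃ ν : W → W → W → W,
      (∃ C' ρ', 0 ≤ C' ∧ ProperCtrl ρ' ∧ IsCoarseMedian ν C' ρ') ∧
      ∃ K : ℝ, ∀ x y z : W, dist (f (ν x y z)) (μ (f x) (f y) (f z)) ≤ K := by
  obtain ⟨hctrl, hsymm, hloc, hfour⟩ := hμ
  obtain ⟨⟨ρf, hρf, hf⟩, g, ⟨ρg, hρg, hg⟩, ⟨L, hL⟩, ⟨K, hK⟩⟩ := hf
  simp only [Function.comp_apply, id_eq] at hL hK
  set M := max K 0
  have hM : 0 ≤ M := le_max_right K 0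
  have hKM (p : X) : dist (f (g p)) p ≤ M := (hK p).trans (le_max_left K 0)
  have hself (p : X) : dist p p ≤ M := (dist_self p).trans_le hM
  have hgC : 0 ≤ ρg C := hρg.2.2 C hC
  have hgM : 0 ≤ ρg (ρ M) := hρg.2.2 _ (hρ.2.2 M hM)
  have hL0 : 0 ≤ max L 0 := le_max_right L 0
  refine ⟨fun x y z => g (μ (f x) (f y) (f z)),
    ⟨ρg C + max L 0 + 2 * ρg (ρ M), ρg ∘ ρ ∘ ρf, by positivity, ⟨?_, ?_, ?_⟩,
      ?_, ?_, ?_, ?_⟩, K, fun x y z => hK _⟩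
  · exact hρg.1.comp (hρ.1.comp hρf.1)
  · exact hρg.2.1.comp (hρ.2.1.comp hρf.2.1)
  · exact fun t ht => hρg.2.2 _ (hρ.2.2 _ (hρf.2.2 t ht))
  · intro x x' y y' z z' t hx hy hz
    exact hg _ _ _ (hctrl _ _ _ _ _ _ _ (hf _ _ _ hx) (hf _ _ _ hy) (hf _ _ _ hz))
  · intro τ v
    have h := hg _ _ _ (hsymm τ (f ∘ v))
    simp only [Function.comp_apply] at h
    linarith
  · intro x y
    have h := hg _ _ _ (hloc (f x) (f y))
    have h' := dist_triangle (g (μ (f x) (f x) (f y))) (g (f x)) x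
    linarith [hL x, le_max_left L 0]
  · intro x y z w
    have h₁ := hg _ _ _ (hctrl _ _ _ _ _ _ M (hKM (μ (f x) (f w) (f y)))
      (hself (f w)) (hself (f z)))
    have h₂ := hg _ _ _ (hfour (f x) (f y) (f z) (f w))
    have h₃ := hg _ _ _ (hctrl _ _ _ _ _ _ M (hself (f x)) (hself (f w))
      (hKM (μ (f y) (f w) (f z))))
    rw [dist_comm] at h₃
    refine (dist_triangle4 _ _ _ _).trans ((add_le_add_three h₁ h₂ h₃).trans ?_)
    linarith
end

section
/- For every C ≥ 0, every increasing proper function ρ : [0,∞) → [0,∞) and every L ≥ 0, there exists L' ≥ 0, depending only on C, L and ρ, with the following property: for every metric space X with a coarse median μ with constant C and upper control ρ, and all x, y, z ∈ X, if z ∈ [x,y]_L then [x,z]_L ⊆ [x,y]_{L'}; that is, if d(μ(x,y,z), z) ≤ L and d(μ(x,z,w), w) ≤ L then d(μ(x,y,w), w) ≤ L'. (One may take L' = L + 3C + ρ(L) + ρ(C) + ρ(L+C).) -/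
open Filter

universe u v

/-- A coarse median is symmetric in its first two arguments up to the constant `C`. -/
theorem IsCoarseMedian.dist_swap_le {X : Type*} [MetricSpace X] {μ : X → X → X → X} {C : ℝ}
    {ρ : ℝ → ℝ} (hμ : IsCoarseMedian μ C ρ) (a b c : X) :
    dist (μ b a c) (μ a b c) ≤ C :=
  hμ.2.1 (Equiv.swap 0 1) ![a, b, c]

/-- coarse intervals are coarsely transitive. -/
theorem coarse_interval_trans (C L : ℝ) (ρ : ℝ → ℝ)
    (hC : 0 ≤ C) (hL : 0 ≤ L) (hρ : ProperCtrl ρ) :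
    ∃ L' : ℝ, 0 ≤ L' ∧
      ∀ (X : Type u) [MetricSpace X], ∀ μ : X → X → X → X, IsCoarseMedian μ C ρ →
        ∀ x y z w : X, dist (μ x y z) z ≤ L → dist (μ x z w) w ≤ L →
          dist (μ x y w) w ≤ L' := by
  have hρ' : 0 ≤ ρ (L + C) := hρ.2.2 _ (by positivity)
  refine ⟨L + 3 * C + 2 * ρ (L + C), by positivity, ?_⟩
  intro X _ μ hμ x y z w hz hw
  have swap := hμ.dist_swap_le
  obtain ⟨control, -, -, fourPoint⟩ := hμ
  have hLC : ∀ a : X, dist a a ≤ L + C := fun a => by rw [dist_self]; positivity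
  have hyxz : dist (μ y x z) z ≤ L + C := by
    linarith [dist_triangle (μ y x z) (μ x y z) z, swap x y z]
  have hzxw : dist (μ z x w) w ≤ L + C := by
    linarith [dist_triangle (μ z x w) (μ x z w) w, swap x z w]
  have outer := control _ _ x x w w _ hyxz (hLC x) (hLC w)
  have inner := control y y x x _ _ _ (hLC y) (hLC x) hzxw
  have assoc := fourPoint y z w x
  have hxy := swap x y w
  rw [dist_comm] at assoc inner hxy
  have h₁ := dist_triangle4 (μ x y w) (μ y x w) (μ y x (μ z x w)) (μ (μ y x z) x w)
  have h₂ := dist_triangle4 (μ x y w) (μ (μ y x z) x w) (μ z x w) w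
  linarith
end

section
/- For every C ≥ 0 and every increasing proper function ρ : [0,∞) → [0,∞) there exists E ≥ 0, depending only on C and ρ, such that for every metric space X with a coarse median μ with constant C and upper control ρ, and all v, w, x, y, z ∈ X, one has d(μ(v, w, μ(x,y,z)), μ(μ(v,w,x), μ(v,w,y), z)) ≤ E. -/
open Filter

universe u v

/-- A ternary operation that is symmetric, satisfies the majority law, and satisfies the
four-point (associativity) condition. -/
structure IsMedianOp {M : Type*} (m : M → M → M → M) : Prop where
  swap_left : ∀ a b c, m a b c = m b a c
  swap_right : ∀ a b c, m a b c = m a c b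
  majority : ∀ a b, m a a b = a
  assoc : ∀ a b c w, m (m a w b) w c = m a w (m b w c)

namespace IsMedianOp

variable {M : Type*} {m : M → M → M → M}

/-- `b` lies between `a` and `c`. -/
def Between (m : M → M → M → M) (a b c : M) : Prop := m a b c = b

theorem Between.symm (hm : IsMedianOp m) {a b c : M} (h : Between m a b c) :
    Between m c b a := by
  unfold Between at *
  rw [hm.swap_left, hm.swap_right, hm.swap_left, h]

/-- If `x` is between `a` and `y`, and `y` between `a` and `z`, then `x` is between `a` and `z`. -/
theorem Between.trans (hm : IsMedianOp m) {a x y z : M} (h₁ : Between m a x y)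
    (h₂ : Between m a y z) : Between m a x z := by
  unfold Between at *
  rw [hm.swap_left] at h₁ h₂ ⊢
  have h := hm.assoc x y z a
  rwa [h₁, h₂, h₁] at h

/-- If `x` is between `a` and `y`, and `y` between `a` and `z`, then `y` is between `x` and `z`. -/
theorem Between.right_of (hm : IsMedianOp m) {a x y z : M} (h₁ : Between m a x y)
    (h₂ : Between m a y z) : Between m x y z := by
  unfold Between at *
  have h := hm.assoc x a z y
  rwa [h₂, hm.swap_right x y a, hm.swap_left x a y, h₁, hm.swap_right x y y, hm.swap_left x y y,
    hm.swap_right y x y, hm.majority] at h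

theorem Between.antisymm (hm : IsMedianOp m) {a x y : M} (h₁ : Between m a x y)
    (h₂ : Between m a y x) : x = y := by
  unfold Between at *
  rw [← h₁, hm.swap_right, h₂]

theorem between_left (hm : IsMedianOp m) (a b c : M) : Between m a (m a b c) b := by
  unfold Between
  have h := hm.assoc b b c a
  rw [hm.swap_right b a b, hm.majority] at h
  rw [hm.swap_right, hm.swap_left a b, hm.swap_left a b c]
  exact h.symm

theorem between_mid (hm : IsMedianOp m) (a b c : M) : Between m a (m a b c) c := by
  rw [hm.swap_right]; exact hm.between_left a c b

theorem between_right (hm : IsMedianOp m) (a b c : M) : Between m b (m a b c) c := by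
  rw [hm.swap_left]; exact hm.between_mid b a c

/-- A lower bound of `b` and `c` in the order based at `a` is below their median with `a`. -/
theorem Between.median (hm : IsMedianOp m) {a b c p : M} (h₁ : Between m a p b)
    (h₂ : Between m a p c) : Between m a p (m a b c) := by
  unfold Between at *
  rw [hm.swap_left] at h₁ h₂ ⊢
  have h := hm.assoc p b c a
  rw [h₁, h₂] at h
  rw [hm.swap_left a b c]
  exact h.symm

/-- The median is the only point between each pair of its arguments. -/
theorem eq_median (hm : IsMedianOp m) {a b c p : M} (hab : Between m a p b)
    (hbc : Between m b p c) (hac : Between m a p c) : p = m a b c := by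
  have ha := hab.median hm hac
  have hb : Between m b p (m a b c) := by
    rw [hm.swap_left]; exact (hab.symm hm).median hm hbc
  exact hb.antisymm hm ((ha.right_of hm (hm.between_left a b c)).symm hm)

/-- The median of `v`, `q`, `g` is the gate of `v` in the interval from `q` to `g`. -/
theorem between_gate (hm : IsMedianOp m) (v : M) {q r g : M} (h : Between m q r g) :
    Between m v (m v q g) r := by
  have hqar := hm.between_right v q r
  have hgbr := hm.between_right v g r
  have hva := hm.between_left v q r
  have hvb := hm.between_left v g r
  have hmeet : m v (m v q r) (m v g r) = m v (m v q g) r := by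
    have e₁ := hm.assoc q r (m g v r) v
    have e₂ := hm.assoc r r g v
    have e₃ := hm.assoc q g r v
    rw [hm.swap_right r v r, hm.majority] at e₂
    rw [hm.swap_right g v r, hm.swap_left g r v, hm.swap_right r g v, ← e₂,
      hm.swap_right r v g, hm.swap_left r g v, hm.swap_right g r v] at e₁
    rw [hm.swap_left v (m v q r), hm.swap_left v (m v q g), hm.swap_left v q, hm.swap_left v q,
      hm.swap_left v g, e₁, e₃]
  set a := m v q r
  set b := m v g r
  set i := m v q g with hi
  set k := m v a b with hk
  have hqag : Between m q a g := hqar.trans hm h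
  have harg : Between m a r g := hqar.right_of hm h
  have hgra : Between m g r a := harg.symm hm
  have hgba : Between m g b a := hgbr.trans hm hgra
  have hgbq : Between m g b q := hgbr.trans hm (h.symm hm)
  have hqab : Between m q a b := (hgba.right_of hm (hqag.symm hm)).symm hm
  have hkab : Between m a k b := hm.between_right v a b
  have hbkq : Between m b k q := (hkab.symm hm).trans hm (hqab.symm hm)
  have hkqg : Between m q k g := (hbkq.symm hm).trans hm (hgbq.symm hm)
  have hvki : Between m v k i := by rw [hmeet]; exact hm.between_left v i r
  have hkiq : Between m k i q := hvki.right_of hm (hm.between_left v q g)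
  have hkig : Between m k i g := hvki.right_of hm (hm.between_mid v q g)
  have hik : i = k :=
    (hm.eq_median hkiq (hm.between_right v q g) hkig).trans ((hm.swap_left k q g).trans hkqg)
  unfold Between
  rw [← hmeet, ← hik]

/-- Intervals are convex. -/
theorem Between.convex (hm : IsMedianOp m) {v w q r g : M} (hq : Between m v q w)
    (hg : Between m v g w) (h : Between m q r g) : Between m v r w := by
  have hsq : Between m r (m r v w) q := hm.between_gate r hq
  have hsg : Between m r (m r v w) g := hm.between_gate r hg
  have hrs : r = m r v w :=
    (((hsq.symm hm).right_of hm h).symm hm).antisymm hm (hsg.symm hm)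
  unfold Between
  rw [hm.swap_left]
  exact hrs.symm

/-- Projecting onto an interval preserves betweenness. -/
theorem Between.map_left (hm : IsMedianOp m) (v w : M) {x u z : M} (h : Between m x u z) :
    Between m (m v w x) (m v w u) z := by
  have rot : ∀ t, m v w t = m t v w := fun t ↦ by rw [hm.swap_right, hm.swap_left]
  have hp : Between m v (m v w u) w := hm.between_left v w u
  have hq : Between m v (m v w x) w := hm.between_left v w x
  have gate_u : ∀ {t}, Between m v t w → Between m u (m v w u) t := fun ht ↦ by
    rw [rot]; exact hm.between_gate u ht
  have gate_x : ∀ {t}, Between m v t w → Between m x (m v w x) t := fun ht ↦ by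
    rw [rot]; exact hm.between_gate x ht
  set p := m v w u
  set q := m v w x
  have hpeq : Between m p (m p q z) q := hm.between_left p q z
  have hpez : Between m p (m p q z) z := hm.between_mid p q z
  have hqez : Between m q (m p q z) z := hm.between_right p q z
  set e := m p q z
  have hpex : Between m p e x := hpeq.trans hm ((gate_x hp).symm hm)
  have hpeu : Between m p e u := (hpex.median hm hpez).trans hm (hm.between_gate p h)
  have hupe : Between m u p e := gate_u (Between.convex hm hp hq hpeq)
  have hep : e = p := (hpeu.symm hm).antisymm hm hupe
  rwa [hep] at hqez

/-- The five-point condition in a median algebra. -/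
theorem five_point (hm : IsMedianOp m) (v w x y z : M) :
    m v w (m x y z) = m (m v w x) (m v w y) z := by
  have idem : ∀ t, m v w (m v w t) = m v w t := fun t ↦ by
    rw [hm.swap_right]; exact hm.between_left v w t
  refine hm.eq_median ?_ ((hm.between_right x y z).map_left hm v w)
    ((hm.between_mid x y z).map_left hm v w)
  have h := (((hm.between_left x y z).map_left hm v w).symm hm).map_left hm v w
  rw [idem] at h
  exact h.symm hm

end IsMedianOp

section BoundedQuotient

variable {X : ℕ → Type*} [∀ n, MetricSpace (X n)]

/-- Two sequences of points are equivalent when they stay at bounded distance. -/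
def boundedSetoid (X : ℕ → Type*) [∀ n, MetricSpace (X n)] : Setoid (∀ n, X n) where
  r f g := ∃ B : ℝ, ∀ n, dist (f n) (g n) ≤ B
  iseqv :=
    { refl := fun f ↦ ⟨0, fun n ↦ (dist_self (f n)).le⟩
      symm := fun ⟨B, hB⟩ ↦ ⟨B, fun n ↦ by rw [dist_comm]; exact hB n⟩
      trans := fun ⟨B, hB⟩ ⟨B', hB'⟩ ↦
        ⟨B + B', fun n ↦ (dist_triangle _ _ _).trans (add_le_add (hB n) (hB' n))⟩ }

/-- The operation induced by a uniform family of coarse medians on bounded-distance classes. -/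
def boundedMedian {μ : ∀ n, X n → X n → X n → X n} {C : ℝ} {ρ : ℝ → ℝ}
    (hμ : ∀ n, IsCoarseMedian (μ n) C ρ) (a b c : Quotient (boundedSetoid X)) :
    Quotient (boundedSetoid X) :=
  Quotient.liftOn₂ a b
    (fun f g ↦ Quotient.map (fun h n ↦ μ n (f n) (g n) (h n))
      (by
        rintro h h' ⟨B, hB⟩
        exact ⟨ρ (max B 0), fun n ↦ (hμ n).1 _ _ _ _ _ _ _ (by simp) (by simp)
          ((hB n).trans (le_max_left _ _))⟩) c)
    (by
      rintro f g f' g' ⟨B, hB⟩ ⟨B', hB'⟩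
      induction c using Quotient.inductionOn with | _ h
      exact Quotient.sound ⟨ρ (max (max B B') 0), fun n ↦ (hμ n).1 _ _ _ _ _ _ _
        ((hB n).trans (by simp)) ((hB' n).trans (by simp)) (by simp)⟩)

theorem isMedianOp_boundedMedian {μ : ∀ n, X n → X n → X n → X n} {C : ℝ} {ρ : ℝ → ℝ}
    (hμ : ∀ n, IsCoarseMedian (μ n) C ρ) : IsMedianOp (boundedMedian hμ) where
  swap_left a b c := by
    induction a using Quotient.inductionOn with | _ f
    induction b using Quotient.inductionOn with | _ g
    induction c using Quotient.inductionOn with | _ h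
    refine Quotient.sound ⟨C, fun n ↦ ?_⟩
    simpa [Equiv.swap_apply_def] using (hμ n).2.1 (Equiv.swap 0 1) ![g n, f n, h n]
  swap_right a b c := by
    induction a using Quotient.inductionOn with | _ f
    induction b using Quotient.inductionOn with | _ g
    induction c using Quotient.inductionOn with | _ h
    refine Quotient.sound ⟨C, fun n ↦ ?_⟩
    simpa [Equiv.swap_apply_def] using (hμ n).2.1 (Equiv.swap 1 2) ![f n, h n, g n]
  majority a b := by
    induction a using Quotient.inductionOn with | _ f
    induction b using Quotient.inductionOn with | _ g
    exact Quotient.sound ⟨C, fun n ↦ (hμ n).2.2.1 _ _⟩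
  assoc a b c w := by
    induction a using Quotient.inductionOn with | _ f
    induction b using Quotient.inductionOn with | _ g
    induction c using Quotient.inductionOn with | _ h
    induction w using Quotient.inductionOn with | _ k
    exact Quotient.sound ⟨C, fun n ↦ (hμ n).2.2.2 _ _ _ _⟩

end BoundedQuotient

/-- the coarse five-point condition. -/
theorem coarse_five_point (C : ℝ) (ρ : ℝ → ℝ) (hC : 0 ≤ C) (hρ : ProperCtrl ρ) :
    ∃ E : ℝ, 0 ≤ E ∧
      ∀ (X : Type u) [MetricSpace X], ∀ μ : X → X → X → X, IsCoarseMedian μ C ρ →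
        ∀ v w x y z : X,
          dist (μ v w (μ x y z)) (μ (μ v w x) (μ v w y) z) ≤ E := by
  by_contra! hcon
  choose X inst μ hμ v w x y z hlt using fun n : ℕ ↦ hcon n n.cast_nonneg
  obtain ⟨B, hB⟩ := Quotient.exact
    ((isMedianOp_boundedMedian hμ).five_point (Quotient.mk (boundedSetoid X) v)
      (Quotient.mk _ w) (Quotient.mk _ x) (Quotient.mk _ y) (Quotient.mk _ z))
  obtain ⟨n, hn⟩ := exists_nat_gt B
  exact absurd (hB n) (not_le.mpr (hn.trans (hlt n)))
end

section
/- For all C, L, E ≥ 0 and every increasing proper function ρ : [0,∞) → [0,∞), there exists R ≥ 0, depending only on C, L, E and ρ, with the following property: for every metric space X with a coarse median μ with constant C and upper control ρ which satisfies the E-coarse five-point condition, and all x, y, z, O ∈ X, if O ∈ [x,y]_L ∩ [y,z]_L ∩ [z,x]_L (i.e. d(μ(x,y,O), O) ≤ L, d(μ(y,z,O), O) ≤ L and d(μ(z,x,O), O) ≤ L), then d(O, μ(x,y,z)) ≤ R. -/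
open Filter

universe u v

namespace IsCoarseMedian

variable {X : Type*} [MetricSpace X] {μ : X → X → X → X} {C : ℝ} {ρ : ℝ → ℝ}

theorem dist_rotate_le (h : IsCoarseMedian μ C ρ) (a b c : X) :
    dist (μ b c a) (μ a b c) ≤ C := by
  simpa [finRotate_apply] using h.2.1 (finRotate 3) ![a, b, c]

theorem dist_swap_right_le (h : IsCoarseMedian μ C ρ) (a b c : X) :
    dist (μ a c b) (μ a b c) ≤ C := by
  simpa [Equiv.swap_apply_of_ne_of_ne] using h.2.1 (Equiv.swap 1 2) ![a, b, c]

/-- If both left arguments are close to `p`, the coarse median is close to `p`. -/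
theorem dist_le_of_dist_left_le (h : IsCoarseMedian μ C ρ) {p q r s : X} {t : ℝ}
    (hq : dist q p ≤ t) (hr : dist r p ≤ t) : dist (μ q r s) p ≤ ρ t + C := by
  have hs : dist s s ≤ t := by
    rw [dist_self]
    exact dist_nonneg.trans hq
  exact (dist_triangle _ (μ p p s) _).trans (add_le_add (h.1 _ _ _ _ _ _ _ hq hr hs) (h.2.2.1 p s))

/-- A point coarsely between `a` and `b` and between `c` and `a` is coarsely between `a` and
any point close to the median of `a`, `b`, `c`. -/
theorem dist_median_le_of_mem_intervals (h : IsCoarseMedian μ C ρ) (hC : 0 ≤ C) {L E : ℝ}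
    (h5 : ∀ v w x y z : X, dist (μ v w (μ x y z)) (μ (μ v w x) (μ v w y) z) ≤ E)
    {a b c p m : X} (hab : dist (μ a b p) p ≤ L) (hca : dist (μ c a p) p ≤ L)
    (hm : dist m (μ b c a) ≤ C) :
    dist (μ p m a) p ≤ C + (ρ C + E + (ρ (C + L) + C)) := by
  have hb : dist (μ a p b) p ≤ C + L :=
    (dist_triangle _ _ _).trans (add_le_add (h.dist_swap_right_le a b p) hab)
  have hc : dist (μ a p c) p ≤ C + L :=
    (dist_triangle _ _ _).trans (add_le_add (h.dist_rotate_le c a p) hca)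
  have hclose := h.dist_le_of_dist_left_le (s := a) hb hc
  have hreplace : dist (μ a p m) (μ a p (μ b c a)) ≤ ρ C :=
    h.1 _ _ _ _ _ _ _ (by simpa using hC) (by simpa using hC) hm
  have hrot := h.dist_rotate_le a p m
  have hfive := h5 a p b c a
  have htri := dist_triangle4 (μ a p m) (μ a p (μ b c a)) (μ (μ a p b) (μ a p c) a) p
  have htri' := dist_triangle (μ p m a) (μ a p m) p
  linarith

end IsCoarseMedian

/-- coarse tripod lemma. -/
theorem coarse_tripod (C L E : ℝ) (ρ : ℝ → ℝ)
    (hC : 0 ≤ C) (hL : 0 ≤ L) (hE : 0 ≤ E) (hρ : ProperCtrl ρ) :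
    ∃ R : ℝ, 0 ≤ R ∧
      ∀ (X : Type u) [MetricSpace X], ∀ μ : X → X → X → X, IsCoarseMedian μ C ρ →
        (∀ v w x y z : X, dist (μ v w (μ x y z)) (μ (μ v w x) (μ v w y) z) ≤ E) →
        ∀ x y z O : X,
          dist (μ x y O) O ≤ L → dist (μ y z O) O ≤ L → dist (μ z x O) O ≤ L →
          dist O (μ x y z) ≤ R := by
  have hnn := hρ.2.2
  have hK : 0 ≤ C + (ρ C + E + (ρ (C + L) + C)) := by
    have h₁ := hnn C hC
    have h₂ := hnn (C + L) (add_nonneg hC hL)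
    positivity
  refine ⟨E + (ρ (C + (ρ C + E + (ρ (C + L) + C))) + C) + (C + C), ?_, ?_⟩
  · have h₃ := hnn _ hK
    positivity
  intro X _ μ h h5 x y z O hxy hyz hzx
  set m := μ x y z with hm
  have hx : dist (μ O m x) O ≤ C + (ρ C + E + (ρ (C + L) + C)) :=
    h.dist_median_le_of_mem_intervals hC h5 hxy hzx
      (by rw [dist_comm]; exact h.dist_rotate_le x y z)
  have hy : dist (μ O m y) O ≤ C + (ρ C + E + (ρ (C + L) + C)) :=
    h.dist_median_le_of_mem_intervals hC h5 hyz hxy (h.dist_rotate_le z x y)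
  have hclose := h.dist_le_of_dist_left_le (s := z) hx hy
  have hfive : dist (μ O m m) (μ (μ O m x) (μ O m y) z) ≤ E := h5 O m x y z
  have hrot := h.dist_rotate_le O m m
  have hloc := h.2.2.1 m O
  have htri := dist_triangle (μ O m m) (μ (μ O m x) (μ O m y) z) O
  have htri' := dist_triangle_left O m (μ O m m)
  have htri'' := dist_triangle_left (μ O m m) m (μ m m O)
  linarith
end

section
/- Let X be a metric space with a coarse median μ with constant C ≥ 0 and upper control ρ, satisfying the E-coarse five-point condition. Let x, y, z, O ∈ X and L ≥ 0, and suppose d(μ(x,y,O), O) ≤ L and d(μ(z,x,O), O) ≤ L. Then, setting m = μ(x,y,z), one has d(μ(O, m, x), O) ≤ ρ(L) + E + ρ(L + C) + L. -/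
open Filter

universe u v

/-- a step in the coarse tripod lemma. -/
theorem coarse_tripod_step {X : Type*} [MetricSpace X]
    (μ : X → X → X → X) (C E L : ℝ) (ρ : ℝ → ℝ)
    (hC : 0 ≤ C) (hE : 0 ≤ E) (hL : 0 ≤ L) (hρ : ProperCtrl ρ)
    (hμ : IsCoarseMedian μ C ρ)
    (h5 : ∀ v w x y z : X, dist (μ v w (μ x y z)) (μ (μ v w x) (μ v w y) z) ≤ E)
    (x y z O : X)
    (h1 : dist (μ x y O) O ≤ L) (h2 : dist (μ z x O) O ≤ L) :
    dist (μ O (μ x y z) x) O ≤ ρ L + E + ρ (L + C) + L := by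
  obtain ⟨hctrl, hsymm, -, -⟩ := hμ
  have hrot : dist (μ z x O) (μ O z x) ≤ C := hsymm (finRotate 3) ![O, z, x]
  have hzx : dist (μ O z x) O ≤ L + C := by
    have := dist_triangle_left (μ O z x) O (μ z x O)
    linarith
  have hfirst : dist (μ O (μ x y z) x) (μ (μ x y O) (μ x y z) x) ≤ ρ L :=
    hctrl _ _ _ _ _ _ L (by rwa [dist_comm]) (by simpa using hL) (by simpa using hL)
  have hfive : dist (μ (μ x y O) (μ x y z) x) (μ x y (μ O z x)) ≤ E := by
    rw [dist_comm]
    exact h5 x y O z x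
  have hlast : dist (μ x y (μ O z x)) (μ x y O) ≤ ρ (L + C) :=
    hctrl _ _ _ _ _ _ (L + C) (by simpa using add_nonneg hL hC)
      (by simpa using add_nonneg hL hC) hzx
  have htri := dist_triangle4 (μ O (μ x y z) x) (μ (μ x y O) (μ x y z) x) (μ x y (μ O z x)) O
  have htri' := dist_triangle (μ x y (μ O z x)) (μ x y O) O
  linarith
end

section
/- Let (X, d) be a metric space and let μ : X³ → X be a map with upper control ρ, i.e. max(d(x,x'), d(y,y'), d(z,z')) ≤ t implies d(μ(x,y,z), μ(x',y',z')) ≤ ρ(t), where ρ is increasing. Then for every σ ≥ 0, the map μ is 1-Lipschitz as a map from (X, d_σ)³ (with the max metric) to (X, d_{ρ(σ)}): for all x, y, z, x', y', z' ∈ X and n ∈ ℕ, if d_σ(x,x') ≤ n, d_σ(y,y') ≤ n and d_σ(z,z') ≤ n, then d_{ρ(σ)}(μ(x,y,z), μ(x',y',z')) ≤ n. -/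
open Filter

universe u v

open ENNReal in
/-- The Rips metric at scale `σ`: `ripsDist σ x y` is the least `n : ℕ` such that `x` and
`y` are joined by a chain of `n` jumps of size at most `σ`, and `∞` if there is no
such chain. -/
noncomputable def ripsDist {X : Type*} [MetricSpace X] (σ : ℝ) (x y : X) : ℝ≥0∞ :=
  sInf {e : ℝ≥0∞ | ∃ n : ℕ, e = n ∧ ∃ c : ℕ → X, c 0 = x ∧ c n = y ∧
    ∀ i < n, dist (c i) (c (i + 1)) ≤ σ}

theorem ripsDist_le_of_chain {X : Type*} [MetricSpace X] {σ : ℝ} {n : ℕ} (c : ℕ → X)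
    (hc : ∀ i < n, dist (c i) (c (i + 1)) ≤ σ) : ripsDist σ (c 0) (c n) ≤ n :=
  sInf_le ⟨n, rfl, c, rfl, rfl, hc⟩

theorem exists_chain_of_ripsDist_le {X : Type*} [MetricSpace X] {σ : ℝ} (hσ : 0 ≤ σ)
    {x y : X} {n : ℕ} (h : ripsDist σ x y ≤ n) :
    ∃ c : ℕ → X, c 0 = x ∧ c n = y ∧ ∀ i, dist (c i) (c (i + 1)) ≤ σ := by
  have hlt : ripsDist σ x y < ((n + 1 : ℕ) : ENNReal) :=
    h.trans_lt (Nat.cast_lt.2 n.lt_succ_self)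
  obtain ⟨_, ⟨m, rfl, c, rfl, rfl, hc⟩, hm⟩ := sInf_lt_iff.1 hlt
  have hmn : m ≤ n := Nat.lt_succ_iff.1 (Nat.cast_lt.1 hm)
  refine ⟨fun i ↦ c (min i m), by simp, by simp [hmn], fun i ↦ ?_⟩
  rcases lt_or_ge i m with hi | hi
  · simpa [min_eq_left hi.le, min_eq_left (Nat.succ_le_of_lt hi)] using hc i hi
  · simpa [min_eq_right hi, min_eq_right (hi.trans i.le_succ)] using hσ

/-- a controlled ternary operator is 1-Lipschitz from the scale-`σ` Rips
metric (max metric on triples) to the scale-`ρ σ` Rips metric. -/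
theorem rips_median_one_lipschitz {X : Type*} [MetricSpace X]
    (μ : X → X → X → X) (ρ : ℝ → ℝ) (hρ : Monotone ρ)
    (hctrl : ∀ (x x' y y' z z' : X) (t : ℝ), dist x x' ≤ t → dist y y' ≤ t →
      dist z z' ≤ t → dist (μ x y z) (μ x' y' z') ≤ ρ t)
    (σ : ℝ) (hσ : 0 ≤ σ) :
    ∀ (x y z x' y' z' : X) (n : ℕ),
      ripsDist σ x x' ≤ n → ripsDist σ y y' ≤ n → ripsDist σ z z' ≤ n →
      ripsDist (ρ σ) (μ x y z) (μ x' y' z') ≤ n := by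
  intro x y z x' y' z' n hx hy hz
  obtain ⟨a, rfl, rfl, ha⟩ := exists_chain_of_ripsDist_le hσ hx
  obtain ⟨b, rfl, rfl, hb⟩ := exists_chain_of_ripsDist_le hσ hy
  obtain ⟨c, rfl, rfl, hc⟩ := exists_chain_of_ripsDist_le hσ hz
  exact ripsDist_le_of_chain (fun i ↦ μ (a i) (b i) (c i)) fun i _ ↦
    hctrl _ _ _ _ _ _ σ (ha i) (hb i) (hc i)
end

section
/- For all constants C ≥ 0, E ≥ 0, every increasing proper function ρ : [0,∞) → [0,∞), and all B', K with K ≥ B' ≥ C + ρ(C), there exists R' ≥ 0, depending only on C, E, B', K and ρ, with the following property. Let (A, μ_A) and (B, μ_B) be metric spaces each carrying a coarse median with constant C and upper control ρ and satisfying the E-coarse five-point condition. Let θ : B → A be any function and O ∈ B a point such that for all x, y ∈ B, either d(μ_B(x, y, O), O) ≤ B' or d(θ(x), θ(y)) ≤ B'. Define ℛ := {(a, b) ∈ A × B : d(a, θ(b)) ≤ K or d(b, O) ≤ K}. Then for all (a₁,b₁), (a₂,b₂), (a₃,b₃) ∈ ℛ there exists (a, b) ∈ ℛ with max(d(μ_A(a₁,a₂,a₃),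 a), d(μ_B(b₁,b₂,b₃), b)) ≤ R'. -/
open Filter

universe u v

namespace IsCoarseMedian

variable {X : Type*} [MetricSpace X] {μ : X → X → X → X} {C : ℝ} {ρ : ℝ → ℝ}

theorem dist_swap_right (h : IsCoarseMedian μ C ρ) (x y z : X) :
    dist (μ x z y) (μ x y z) ≤ C := by
  simpa [Equiv.swap_apply_def] using h.2.1 (Equiv.swap 1 2) ![x, y, z]

theorem dist_rotate (h : IsCoarseMedian μ C ρ) (x y z : X) :
    dist (μ y z x) (μ x y z) ≤ C := by
  simpa [finRotate_apply] using h.2.1 (finRotate 3) ![x, y, z]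

theorem dist_left_right_le (h : IsCoarseMedian μ C ρ) (x y : X) :
    dist (μ x y x) x ≤ 2 * C := by
  have h₁ := h.dist_swap_right x x y
  have h₂ := h.2.2.1 x y
  linarith [dist_triangle (μ x y x) (μ x x y) x]

theorem dist_mid_right_le (h : IsCoarseMedian μ C ρ) (x y : X) :
    dist (μ y x x) x ≤ 2 * C := by
  have h₁ := h.dist_rotate y x x
  have h₂ := h.2.2.1 x y
  rw [dist_comm] at h₁
  linarith [dist_triangle (μ y x x) (μ x x y) x]

/-- A coarse median of `x, y, z` lies coarsely between `x` and `y`. -/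
theorem dist_absorb_le (h : IsCoarseMedian μ C ρ) (hC : 0 ≤ C) {x y z m : X}
    (hm : dist m (μ x y z) ≤ C) :
    dist (μ x y m) m ≤ ρ C + ρ (2 * C) + 2 * C := by
  have h₁ := h.1 x x y y m (μ x y z) C (by simpa) (by simpa) hm
  have h₂ := h.2.2.2 x x z y
  have h₃ := h.1 (μ x y x) x y y z z (2 * C) (h.dist_left_right_le x y)
    (by simpa) (by simpa)
  rw [dist_comm] at h₂ hm
  linarith [dist_triangle (μ x y m) (μ x y (μ x y z)) m,
    dist_triangle (μ x y (μ x y z)) (μ (μ x y x) y z) m,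
    dist_triangle (μ (μ x y x) y z) (μ x y z) m]

theorem dist_base_le_of_dist_le (h : IsCoarseMedian μ C ρ) {K : ℝ} (hK : 0 ≤ K) {m b O : X}
    (hb : dist b O ≤ K) : dist (μ m b O) O ≤ ρ K + 2 * C := by
  have h₁ := h.1 m m b O O O K (by simpa) hb (by simpa)
  linarith [dist_triangle (μ m b O) (μ m O O) O, h.dist_mid_right_le O m]

/-- If `m` lies coarsely between `p` and `q`, and `O` lies coarsely between `m` and each of
`p` and `q`, then `m` is close to `O`. -/
theorem dist_le_of_between (h : IsCoarseMedian μ C ρ) (hC : 0 ≤ C) {E δ η : ℝ}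
    (hE : ∀ v w x y z : X, dist (μ v w (μ x y z)) (μ (μ v w x) (μ v w y) z) ≤ E)
    {m p q O : X} (hm : dist (μ p q m) m ≤ δ)
    (hp : dist (μ m p O) O ≤ η) (hq : dist (μ m q O) O ≤ η) :
    dist m O ≤ ρ δ + ρ (C + η) + E + 3 * C := by
  have hδ : 0 ≤ δ := dist_nonneg.trans hm
  have hη : 0 ≤ η := dist_nonneg.trans hp
  have hp' : dist (μ m O p) O ≤ C + η := by
    linarith [dist_triangle (μ m O p) (μ m p O) O, h.dist_swap_right m p O]
  have hq' : dist (μ m O q) O ≤ C + η := by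
    linarith [dist_triangle (μ m O q) (μ m q O) O, h.dist_swap_right m q O]
  have h₁ := h.1 m m O O (μ p q m) m δ (by simpa) (by simpa) hm
  have h₂ := h.1 (μ m O p) O (μ m O q) O m m (C + η) hp' hq'
    (by simpa using add_nonneg hC hη)
  have h₃ := h.dist_left_right_le m O
  rw [dist_comm] at h₁ h₃
  linarith [dist_triangle m (μ m O m) O,
    dist_triangle (μ m O m) (μ m O (μ p q m)) O,
    dist_triangle (μ m O (μ p q m)) (μ (μ m O p) (μ m O q) m) O,
    dist_triangle (μ (μ m O p) (μ m O q) m) (μ O O m) O,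
    hE m O p q m, h.2.2.1 O m]

end IsCoarseMedian

/-- bounded coarse interval image yields uniform approximate median
subalgebras of the pairwise constraint sets. -/
theorem pairwise_constraint_approx_median (C E B' K : ℝ) (ρ : ℝ → ℝ)
    (hC : 0 ≤ C) (hE : 0 ≤ E) (hρ : ProperCtrl ρ)
    (hB' : C + ρ C ≤ B') (hK : B' ≤ K) :
    ∃ R' : ℝ, 0 ≤ R' ∧
      ∀ (A B : Type u) [MetricSpace A] [MetricSpace B],
        ∀ (μA : A → A → A → A) (μB : B → B → B → B),
          IsCoarseMedian μA C ρ → IsCoarseMedian μB C ρ →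
          (∀ v w x y z : A, dist (μA v w (μA x y z)) (μA (μA v w x) (μA v w y) z) ≤ E) →
          (∀ v w x y z : B, dist (μB v w (μB x y z)) (μB (μB v w x) (μB v w y) z) ≤ E) →
          ∀ (θ : B → A) (O : B),
            (∀ x y : B, dist (μB x y O) O ≤ B' ∨ dist (θ x) (θ y) ≤ B') →
            ∀ a₁ b₁ a₂ b₂ a₃ b₃,
              (dist a₁ (θ b₁) ≤ K ∨ dist b₁ O ≤ K) →
              (dist a₂ (θ b₂) ≤ K ∨ dist b₂ O ≤ K) →
              (dist a₃ (θ b₃) ≤ K ∨ dist b₃ O ≤ K) →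
              ∃ (a : A) (b : B), (dist a (θ b) ≤ K ∨ dist b O ≤ K) ∧
                max (dist (μA a₁ a₂ a₃) a) (dist (μB b₁ b₂ b₃) b) ≤ R' := by
  have hρC : 0 ≤ ρ C := hρ.2.2 C hC
  have hB'0 : 0 ≤ B' := by linarith
  have hK0 : 0 ≤ K := hB'0.trans hK
  set δ : ℝ := ρ C + ρ (2 * C) + 2 * C with hδ
  set η : ℝ := B' + ρ K + 2 * C with hη
  have hδ0 : 0 ≤ δ := by
    have := hρ.2.2 (2 * C) (by linarith)
    linarith
  have hρK : 0 ≤ ρ K := hρ.2.2 K hK0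
  have hη0 : 0 ≤ η := by linarith
  set D : ℝ := ρ δ + ρ (C + η) + E + 3 * C with hD
  have hD0 : 0 ≤ D := by
    have h₁ := hρ.2.2 δ hδ0
    have h₂ := hρ.2.2 (C + η) (by linarith)
    linarith
  have hρBK : 0 ≤ ρ (B' + K) := hρ.2.2 _ (by linarith)
  refine ⟨D + ρ (B' + K) + 2 * C, by linarith, ?_⟩
  intro A B _ _ μA μB hA hB _ hEB θ O hθ a₁ b₁ a₂ b₂ a₃ b₃ h₁ h₂ h₃
  set m := μB b₁ b₂ b₃ with hm
  by_cases hmO : dist m O ≤ D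
  · refine ⟨μA a₁ a₂ a₃, O, Or.inr (by simpa), ?_⟩
    rw [dist_self]
    exact max_le (by linarith) (by linarith)
  have key : ∀ a b, (dist a (θ b) ≤ K ∨ dist b O ≤ K) →
      dist a (θ m) ≤ B' + K ∨ dist (μB m b O) O ≤ η := by
    rintro a b (hab | hbO)
    · rcases hθ m b with hmb | hmb
      · exact Or.inr (by linarith)
      · rw [dist_comm] at hmb
        exact Or.inl (by linarith [dist_triangle a (θ b) (θ m)])
    · exact Or.inr (by linarith [hB.dist_base_le_of_dist_le hK0 hbO (m := m)])
  have far : ∀ {p q r : B}, dist m (μB p q r) ≤ C →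
      dist (μB m p O) O ≤ η → dist (μB m q O) O ≤ η → False := fun hr hp hq =>
    hmO (hB.dist_le_of_between hC hEB (hB.dist_absorb_le hC hr) hp hq)
  have m₁₂ : dist m (μB b₁ b₂ b₃) ≤ C := by simpa [hm]
  have m₁₃ : dist m (μB b₁ b₃ b₂) ≤ C := by
    simpa only [dist_comm] using hB.dist_swap_right b₁ b₂ b₃
  have m₂₃ : dist m (μB b₂ b₃ b₁) ≤ C := by
    simpa only [dist_comm] using hB.dist_rotate b₁ b₂ b₃
  have two : ∀ {a a' a'' : A}, dist (μA a₁ a₂ a₃) (μA a a' a'') ≤ C →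
      dist a (θ m) ≤ B' + K → dist a' (θ m) ≤ B' + K →
      dist (μA a₁ a₂ a₃) (θ m) ≤ ρ (B' + K) + 2 * C := by
    intro a a' a'' h ha ha'
    have h₁ := hA.1 a (θ m) a' (θ m) a'' a'' (B' + K) ha ha'
      (by simpa using add_nonneg hB'0 hK0)
    linarith [dist_triangle (μA a₁ a₂ a₃) (μA a a' a'') (θ m),
      dist_triangle (μA a a' a'') (μA (θ m) (θ m) a'') (θ m), hA.2.2.1 (θ m) a'']
  have main : dist (μA a₁ a₂ a₃) (θ m) ≤ ρ (B' + K) + 2 * C := by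
    have n₁₂ : dist (μA a₁ a₂ a₃) (μA a₁ a₂ a₃) ≤ C := by simpa
    have n₁₃ : dist (μA a₁ a₂ a₃) (μA a₁ a₃ a₂) ≤ C := by
      simpa only [dist_comm] using hA.dist_swap_right a₁ a₂ a₃
    have n₂₃ : dist (μA a₁ a₂ a₃) (μA a₂ a₃ a₁) ≤ C := by
      simpa only [dist_comm] using hA.dist_rotate a₁ a₂ a₃
    rcases key a₁ b₁ h₁ with g₁ | g₁ <;> rcases key a₂ b₂ h₂ with g₂ | g₂
    · exact two n₁₂ g₁ g₂
    · rcases key a₃ b₃ h₃ with g₃ | g₃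
      · exact two n₁₃ g₁ g₃
      · exact (far m₂₃ g₂ g₃).elim
    · rcases key a₃ b₃ h₃ with g₃ | g₃
      · exact two n₂₃ g₂ g₃
      · exact (far m₁₃ g₁ g₃).elim
    · exact (far m₁₂ g₁ g₂).elim
  refine ⟨θ m, m, Or.inl (by simpa), max_le (by linarith) ?_⟩
  rw [dist_self]
  linarith
end

section
/- Let (X, d) be a metric space with a coarse median μ with constant C ≥ 0 and upper control ρ. Let U ⊆ X be an R-approximate median subalgebra, i.e. for all x, y, z ∈ U there is u ∈ U with d(μ(x,y,z), u) ≤ R, and let ν : U³ → U be any map with d(ν(x,y,z), μ(x,y,z)) ≤ R for all x, y, z ∈ U. Then ν is a coarse median on U (with the metric inherited from X) with constant C + 2R + 2ρ(R) and upper control t ↦ ρ(t) + 2R; moreover, if ν' : U³ → U is another map with d(ν'(x,y,z), μ(x,y,z)) ≤ R' for all x, y, z ∈ U and some R' ≥ 0, then ν and ν' are close. -/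
open Filter

universe u v

/-- an approximate median subalgebra carries an induced coarse median,
unique up to closeness. -/
theorem approx_median_subalgebra_induced {X : Type*} [MetricSpace X]
    (μ : X → X → X → X) (C R : ℝ) (ρ : ℝ → ℝ)
    (hC : 0 ≤ C) (hR : 0 ≤ R) (hρ : ProperCtrl ρ) (hμ : IsCoarseMedian μ C ρ)
    (U : Set X)
    (hU : ∀ x ∈ U, ∀ y ∈ U, ∀ z ∈ U, ∃ u ∈ U, dist (μ x y z) u ≤ R)
    (ν : U → U → U → U)
    (hν : ∀ x y z : U, dist (ν x y z : X) (μ x y z) ≤ R) :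
    IsCoarseMedian ν (C + 2 * R + 2 * ρ R) (fun t => ρ t + 2 * R) ∧
      ∀ (ν' : U → U → U → U) (R' : ℝ), 0 ≤ R' →
        (∀ x y z : U, dist (ν' x y z : X) (μ x y z) ≤ R') →
        ∃ K : ℝ, ∀ x y z : U, dist (ν x y z) (ν' x y z) ≤ K := by
  obtain ⟨hctrl, hsymm, hloc, hfour⟩ := hμ
  have hρR : 0 ≤ ρ R := hρ.2.2 R hR
  have hν' (x y z : U) : dist (μ x y z) (ν x y z : X) ≤ R := by
    rw [dist_comm]; exact hν x y z
  refine ⟨⟨?_, ?_, ?_, ?_⟩, ?_⟩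
  · intro x x' y y' z z' t hx hy hz
    rw [Subtype.dist_eq] at hx hy hz ⊢
    have h := dist_triangle4 (ν x y z : X) (μ x y z) (μ x' y' z') (ν x' y' z')
    linarith [hν x y z, hctrl x x' y y' z z' t hx hy hz, hν' x' y' z']
  · intro τ v
    rw [Subtype.dist_eq]
    have h := dist_triangle4 (ν (v (τ 0)) (v (τ 1)) (v (τ 2)) : X)
      (μ (v (τ 0)) (v (τ 1)) (v (τ 2))) (μ (v 0) (v 1) (v 2)) (ν (v 0) (v 1) (v 2))
    linarith [hν (v (τ 0)) (v (τ 1)) (v (τ 2)), hsymm τ (fun i => (v i : X)),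
      hν' (v 0) (v 1) (v 2)]
  · intro x y
    rw [Subtype.dist_eq]
    linarith [dist_triangle (ν x x y : X) (μ x x y) x, hν x x y, hloc x y]
  · intro x y z w
    rw [Subtype.dist_eq]
    have hself (a : X) : dist a a ≤ R := by rwa [dist_self]
    have hl := hctrl (ν x w y) (μ x w y) w w z z R (hν x w y) (hself _) (hself _)
    have hr := hctrl x x w w (μ y w z) (ν y w z) R (hself _) (hself _) (hν' y w z)
    have h₁ := dist_triangle4 (ν (ν x w y) w z : X) (μ (ν x w y) w z) (μ (μ x w y) w z)
      (μ x w (μ y w z))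
    have h₂ := dist_triangle4 (ν (ν x w y) w z : X) (μ x w (μ y w z)) (μ x w (ν y w z))
      (ν x w (ν y w z))
    linarith [hν (ν x w y) w z, hfour x y z w, hν' x w (ν y w z)]
  · intro ν' R' _ hν''
    refine ⟨R + R', fun x y z => ?_⟩
    rw [Subtype.dist_eq]
    have h := dist_triangle_right (ν x y z : X) (ν' x y z) (μ x y z)
    linarith [hν x y z, hν'' x y z]
end
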